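/- arXiv:2312.11616 — 2 statements merged into one kernel-verified Lean document; each statement's English description precedes it below -/
import Mathlib

section
/- For every γ = (a b; c d) ∈ SL(2,ℤ) one has E₂(γ·i) = (3/π)(c² + d²) and E₂(γ·α) = (2√3/π)(c² − cd + d²), where α = e^{2πi/3} and γ·τ = (aτ+b)/(cτ+d). In particular E₂(i) = 3/π and E₂(α) = 2√3/π. -/
open Complex

noncomputable section

/-- `e^{2πiτs}`, i.e. `q^s` for `q = e^{2πiτ}`. -/
def qp (τ s : ℂ) : ℂ := Complex.exp (2 * (Real.pi : ℂ) * Complex.I * τ * s)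

/-- Sum of the `k`-th powers of the positive divisors of `n`. -/
def sigmaFn (k n : ℕ) : ℕ := ∑ d ∈ n.divisors, d ^ k

/-- The weight-2 quasimodular Eisenstein series
`E₂(τ) = 1 − 24 ∑_{n≥1} σ₁(n) qⁿ`. -/
def E2 (τ : ℂ) : ℂ := 1 - 24 * ∑' n : ℕ, (sigmaFn 1 (n + 1) : ℂ) * qp τ ((n : ℂ) + 1)

abbrev SL2Z := Matrix.SpecialLinearGroup (Fin 2) ℤ

/-- Möbius action of `SL(2,ℤ)`: `γ·τ = (aτ+b)/(cτ+d)`. -/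
def acts (γ : SL2Z) (τ : ℂ) : ℂ :=
  ((γ.1 0 0 : ℂ) * τ + (γ.1 0 1 : ℂ)) / ((γ.1 1 0 : ℂ) * τ + (γ.1 1 1 : ℂ))

/-- `α = e^{2πi/3}`. -/
def alphaPt : ℂ := Complex.exp (2 * (Real.pi : ℂ) * Complex.I / 3)

lemma aux_E2_eq (z : UpperHalfPlane) : E2 (z : ℂ) = EisensteinSeries.E2 z := by
  rw [EisensteinSeries.E2_eq_tsum_cexp, E2,
    tsum_pnat_eq_tsum_succ (f := fun n ↦ (ArithmeticFunction.sigma 1 n : ℂ) *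
      Complex.exp (2 * (Real.pi : ℂ) * Complex.I * z) ^ n)]
  congr 2
  apply tsum_congr
  intro n
  congr 1
  rw [qp, ← Complex.exp_nat_mul]
  congr 1
  push_cast
  ring

lemma aux_acts (γ : SL2Z) (z : UpperHalfPlane) :
    acts γ (z : ℂ) = ((γ • z : UpperHalfPlane) : ℂ) := by
  rw [UpperHalfPlane.coe_specialLinearGroup_apply, acts]
  simp

lemma aux_transform (γ : SL2Z) (z : UpperHalfPlane) :
    E2 (acts γ (z : ℂ)) = ((γ.1 1 0 : ℂ) * z + (γ.1 1 1 : ℂ)) ^ 2 * E2 (z : ℂ)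
      - 6 * Complex.I / Real.pi * (γ.1 1 0 : ℂ) * ((γ.1 1 0 : ℂ) * z + (γ.1 1 1 : ℂ)) := by
  have h := congrFun (EisensteinSeries.E2_slash_action γ) z
  have hd : ((γ.1 1 0 : ℂ) * z + (γ.1 1 1 : ℂ)) ≠ 0 := by
    have := UpperHalfPlane.denom_ne_zero γ z
    rwa [ModularGroup.denom_apply] at this
  have hp : (Real.pi : ℂ) ≠ 0 := by exact_mod_cast Real.pi_ne_zero
  rw [ModularForm.SL_slash_apply] at h
  simp only [Pi.sub_apply, Pi.smul_apply, EisensteinSeries.D2, ModularGroup.denom_apply,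
    smul_eq_mul, riemannZeta_two] at h
  rw [aux_acts, aux_E2_eq, aux_E2_eq]
  generalize EisensteinSeries.E2 (γ • z) = A at *
  generalize EisensteinSeries.E2 z = B at *
  generalize ((γ.1 1 0 : ℂ) * z + (γ.1 1 1 : ℂ)) = D at *
  rw [zpow_neg, zpow_ofNat] at h
  field_simp at h ⊢
  linear_combination h

lemma aux_sqrt3 : (Real.sqrt 3 : ℂ) ^ 2 = 3 := by
  norm_cast
  exact Real.sq_sqrt (by norm_num)

lemma aux_alpha : alphaPt = -1 / 2 + (Real.sqrt 3 : ℂ) / 2 * Complex.I := by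
  have : alphaPt = Complex.exp (((Real.pi - Real.pi / 3 : ℝ) : ℂ) * Complex.I) := by
    rw [alphaPt]; congr 1; push_cast; ring
  rw [this, Complex.exp_mul_I, ← Complex.ofReal_cos, ← Complex.ofReal_sin, Real.cos_pi_sub,
    Real.sin_pi_sub, Real.cos_pi_div_three, Real.sin_pi_div_three]
  push_cast
  ring

lemma aux_alpha_im : 0 < alphaPt.im := by
  rw [aux_alpha]
  simp

lemma aux_I : E2 Complex.I = 3 / (Real.pi : ℂ) := by
  have h := aux_transform ModularGroup.S UpperHalfPlane.I
  have hp : (Real.pi : ℂ) ≠ 0 := by exact_mod_cast Real.pi_ne_zero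
  simp [acts, ModularGroup.S] at h
  field_simp at h ⊢
  linear_combination h / 2 - 3 * Complex.I_sq

def auxM : SL2Z := ⟨!![0, -1; 1, 1], by simp⟩

lemma aux_al : E2 alphaPt = 2 * (Real.sqrt 3 : ℂ) / (Real.pi : ℂ) := by
  have h := aux_transform auxM ⟨alphaPt, aux_alpha_im⟩
  have hp : (Real.pi : ℂ) ≠ 0 := by exact_mod_cast Real.pi_ne_zero
  have h3 := aux_sqrt3
  have hI := Complex.I_sq
  have ha := aux_alpha
  have hq : alphaPt ^ 2 + alphaPt + 1 = 0 := by
    rw [ha]; linear_combination (1/4 : ℂ) * Complex.I^2 * h3 + (3 / 4 : ℂ) * hI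
  have h0 : alphaPt ≠ 0 := by rintro h; simp [h] at hq
  have h1 : alphaPt + 1 ≠ 0 := by
    intro h; apply h0; have : alphaPt ^ 2 = 0 := by linear_combination hq - h
    simpa using this
  have hfix : acts auxM alphaPt = alphaPt := by
    simp [acts, auxM]
    field_simp
    linear_combination -hq
  simp only [hfix] at h
  simp [auxM] at h
  field_simp at h ⊢
  have h2 : 1 - alphaPt ≠ 0 := by
    intro h
    have h' : alphaPt = 1 := by linear_combination -h
    rw [h'] at hq; norm_num at hq
  apply mul_left_cancel₀ h2
  linear_combination h + E2 alphaPt * Real.pi * hq + (2 * (Real.sqrt 3 : ℂ) - 6 * Complex.I) * ha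
    - 3 * (Real.sqrt 3 : ℂ) * hI + Complex.I * h3

/-- For `γ = (a b; c d) ∈ SL(2,ℤ)`:
`E₂(γ·i) = (3/π)(c²+d²)` and `E₂(γ·α) = (2√3/π)(c²−cd+d²)`;
in particular `E₂(i) = 3/π` and `E₂(α) = 2√3/π`. -/
theorem E2_values_at_elliptic (γ : SL2Z) :
    E2 (acts γ Complex.I) =
      (3 / (Real.pi : ℂ)) * ((γ.1 1 0 : ℂ) ^ 2 + (γ.1 1 1 : ℂ) ^ 2) ∧
    E2 (acts γ alphaPt) =
      (2 * (Real.sqrt 3 : ℂ) / (Real.pi : ℂ)) *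
        ((γ.1 1 0 : ℂ) ^ 2 - (γ.1 1 0 : ℂ) * (γ.1 1 1 : ℂ) + (γ.1 1 1 : ℂ) ^ 2) ∧
    E2 Complex.I = 3 / (Real.pi : ℂ) ∧
    E2 alphaPt = 2 * (Real.sqrt 3 : ℂ) / (Real.pi : ℂ) := by
  have hp : (Real.pi : ℂ) ≠ 0 := by exact_mod_cast Real.pi_ne_zero
  have h3 := aux_sqrt3
  have hI := Complex.I_sq
  refine ⟨?_, ?_, aux_I, aux_al⟩
  · have h := aux_transform γ UpperHalfPlane.I
    simp only [UpperHalfPlane.coe_I, aux_I] at h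
    rw [h]
    field_simp
    linear_combination (-3 * (γ.1 1 0 : ℂ) ^ 2) * hI
  · have h := aux_transform γ ⟨alphaPt, aux_alpha_im⟩
    simp only [aux_al] at h
    rw [h, aux_alpha]
    generalize (γ.1 1 0 : ℂ) = c
    generalize (γ.1 1 1 : ℂ) = d
    generalize (Real.sqrt 3 : ℂ) = s at *
    linear_combination (1 / (Real.pi : ℂ)) * ((2 * Complex.I * c * d + c ^ 2 * (-Complex.I
      + s * Complex.I ^ 2 / 2)) * h3 - 3 / 2 * s * c ^ 2 * hI)
end
end

section
/- With Ω_{ℚ(i)} = Γ(1/4)²/(4π^{3/2}) and Ω_{ℚ(α)} = 3^{1/4} Γ(1/3)³/(4π²), α = e^{2πi/3}, the Eisenstein series satisfy E₄(i) = 12 Ω_{ℚ(i)}⁴ = 3 Γ(1/4)⁸/(2π)⁶ and E₆(α) = 12^{3/2} Ω_{ℚ(α)}⁶ = (27/512) Γ(1/3)^{18}/π^{12}. -/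
open Complex

noncomputable section

/-- `E₄(τ) = 1 + 240 ∑_{n≥1} σ₃(n) qⁿ`. -/
def E4 (τ : ℂ) : ℂ := 1 + 240 * ∑' n : ℕ, (sigmaFn 3 (n + 1) : ℂ) * qp τ ((n : ℂ) + 1)

/-- `E₆(τ) = 1 − 504 ∑_{n≥1} σ₅(n) qⁿ`. -/
def E6 (τ : ℂ) : ℂ := 1 - 504 * ∑' n : ℕ, (sigmaFn 5 (n + 1) : ℂ) * qp τ ((n : ℂ) + 1)

/-- Chowla–Selberg period for `ℚ(i)`: `Ω = Γ(1/4)²/(4π^{3/2})`. -/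
def OmegaI : ℝ := Real.Gamma (1 / 4) ^ 2 / (4 * Real.pi ^ ((3 : ℝ) / 2))

/-- Chowla–Selberg period for `ℚ(α)`: `Ω = 3^{1/4} Γ(1/3)³/(4π²)`. -/
def OmegaAlpha : ℝ := (3 : ℝ) ^ ((1 : ℝ) / 4) * Real.Gamma (1 / 3) ^ 3 / (4 * Real.pi ^ 2)

section helpers

open Set Filter Topology MeasureTheory
open scoped ComplexConjugate
open PeriodPair

lemma real_beta (u v : ℝ) (hu : 0 < u) (hv : 0 < v) :
    ∫ x in Ioo (0:ℝ) 1, x ^ (u - 1) * (1 - x) ^ (v - 1)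
      = Real.Gamma u * Real.Gamma v / Real.Gamma (u + v) := by
  have h := ProbabilityTheory.beta_eq_betaIntegralReal u v hu hv
  rw [ProbabilityTheory.beta] at h
  rw [h, Complex.betaIntegral, intervalIntegral.integral_of_le zero_le_one,
    integral_Ioc_eq_integral_Ioo]
  have : ∫ x in Ioo (0:ℝ) 1, ((x:ℂ) ^ ((u:ℂ) - 1) * (1 - (x:ℂ)) ^ ((v:ℂ) - 1))
     = ∫ x in Ioo (0:ℝ) 1, ((x ^ (u - 1) * (1 - x) ^ (v - 1) : ℝ) : ℂ) := by
    refine setIntegral_congr_fun measurableSet_Ioo fun x hx => ?_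
    simp only [Complex.ofReal_mul]
    rw [Complex.ofReal_cpow hx.1.le, Complex.ofReal_cpow (by linarith [hx.2])]
    push_cast
    rfl
  rw [this, integral_complex_ofReal, Complex.ofReal_re]

noncomputable def conjEquiv (L : PeriodPair) (hc : ∀ x ∈ L.lattice, conj x ∈ L.lattice) :
    L.lattice ≃ L.lattice where
  toFun x := ⟨conj x.1, hc _ x.2⟩
  invFun x := ⟨conj x.1, hc _ x.2⟩
  left_inv x := by simp
  right_inv x := by simp

lemma conj_P (L : PeriodPair) (hc : ∀ x ∈ L.lattice, conj x ∈ L.lattice) (t : ℝ) :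
    conj (weierstrassP L t) = weierstrassP L t := by
  simp only [weierstrassP]
  rw [Complex.conj_tsum, ← (conjEquiv L hc).tsum_eq]
  refine tsum_congr fun l => ?_
  simp [conjEquiv]

lemma conj_dP (L : PeriodPair) (hc : ∀ x ∈ L.lattice, conj x ∈ L.lattice) (t : ℝ) :
    conj (derivWeierstrassP L t) = derivWeierstrassP L t := by
  simp only [derivWeierstrassP]
  rw [map_neg, Complex.conj_tsum, ← (conjEquiv L hc).tsum_eq]
  congr 1
  refine tsum_congr fun l => ?_
  simp [conjEquiv, Complex.conj_ofNat]

lemma conj_G (L : PeriodPair) (hc : ∀ x ∈ L.lattice, conj x ∈ L.lattice) (n : ℕ) :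
    conj (L.G n) = L.G n := by
  simp only [PeriodPair.G]
  rw [Complex.conj_tsum, ← (conjEquiv L hc).tsum_eq]
  refine tsum_congr fun l => ?_
  simp [conjEquiv]

lemma G_mul (L : PeriodPair) (c : ℂ) (hc0 : c ≠ 0) (h : ∀ x ∈ L.lattice, c * x ∈ L.lattice)
    (h' : ∀ x ∈ L.lattice, c⁻¹ * x ∈ L.lattice) (n : ℕ) : L.G n = (c ^ n)⁻¹ * L.G n := by
  let e : L.lattice ≃ L.lattice :=
    { toFun := fun x => ⟨c * x.1, h _ x.2⟩
      invFun := fun x => ⟨c⁻¹ * x.1, h' _ x.2⟩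
      left_inv := fun x => by simp [hc0]
      right_inv := fun x => by simp [hc0] }
  conv_lhs => rw [PeriodPair.G, ← e.tsum_eq]
  rw [PeriodPair.G, ← tsum_mul_left]
  refine tsum_congr fun l => ?_
  simp [e, mul_pow, mul_comm]

section
variable (L : PeriodPair) (hc : ∀ x ∈ L.lattice, conj x ∈ L.lattice)
  (hr : ∀ t ∈ Ioo (0:ℝ) 1, (t:ℂ) ∉ L.lattice)

lemma lat_mem_nhds (z : ℂ) (hz : z ∉ L.lattice) : (L.lattice : Set ℂ)ᶜ ∈ 𝓝 z :=
  L.isClosed_lattice.isOpen_compl.mem_nhds hz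

lemma lat_hp (t : ℝ) (ht : (t:ℂ) ∉ L.lattice) :
    HasDerivAt (fun t : ℝ => (weierstrassP L t).re) (derivWeierstrassP L t).re t := by
  have h : DifferentiableAt ℂ (weierstrassP L) t :=
    L.differentiableOn_weierstrassP.differentiableAt (lat_mem_nhds L _ ht)
  have h1 := h.hasDerivAt
  rw [deriv_weierstrassP] at h1
  exact h1.real_of_complex

lemma lat_hdp (t : ℝ) (ht : (t:ℂ) ∉ L.lattice) :
    HasDerivAt (fun t : ℝ => (derivWeierstrassP L t).re) (deriv (derivWeierstrassP L) t).re t := by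
  have h : DifferentiableAt ℂ (derivWeierstrassP L) t :=
    L.differentiableOn_derivWeierstrassP.differentiableAt (lat_mem_nhds L _ ht)
  exact h.hasDerivAt.real_of_complex

lemma lat_lim : Tendsto (fun t : ℝ => (weierstrassP L t).re) (𝓝[>] 0) atTop := by
  have h0 : ContinuousAt (weierstrassPExcept L 0) 0 :=
    (L.analyticAt_weierstrassPExcept 0).continuousAt
  have h1 : ContinuousAt (fun t : ℝ => (weierstrassPExcept L 0 t).re) 0 := by
    apply Complex.continuous_re.continuousAt.comp
    exact ContinuousAt.comp (f := fun t : ℝ => (t:ℂ)) (by rw [Complex.ofReal_zero]; exact h0)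
      Complex.continuous_ofReal.continuousAt
  have h2 : Tendsto (fun t : ℝ => 1 / t ^ 2) (𝓝[>] 0) atTop := by
    have := (tendsto_pow_atTop (α := ℝ) two_ne_zero).comp (tendsto_inv_nhdsGT_zero (𝕜 := ℝ))
    refine this.congr fun x => ?_
    simp
  refine ((h1.tendsto.mono_left nhdsWithin_le_nhds).add_atTop h2).congr fun t => ?_
  have := L.weierstrassPExcept_add 0 (t:ℂ)
  rw [← this]
  have e : ((1 : ℂ) / ((t:ℂ)) ^ 2) = ((1 / t ^ 2 : ℝ) : ℂ) := by push_cast; rfl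
  simp only [ZeroMemClass.coe_zero, sub_zero, Complex.add_re]
  rw [e]
  simp only [ne_eq, OfNat.ofNat_ne_zero, not_false_eq_true, zero_pow, div_zero, sub_zero,
    Complex.ofReal_re]

/-- second-order ODE -/
lemma lat_ddP (z : ℂ) (hz : z ∉ L.lattice) :
    deriv (derivWeierstrassP L) z = 6 * weierstrassP L z ^ 2 - L.g₂ / 2 := by
  have hcn : IsPreconnected ((L.lattice : Set ℂ)ᶜ) := by
    have hcount : (L.lattice : Set ℂ).Countable := by
      have : Countable L.lattice := L.latticeEquivProd.toEquiv.countable_iff.2 inferInstance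
      exact this
    exact (hcount.isPathConnected_compl_of_one_lt_rank (by simp)).isConnected.isPreconnected
  have han := L.analyticOnNhd_derivWeierstrassP
  have hrel : ∀ w ∉ L.lattice, derivWeierstrassP L w *
      (deriv (derivWeierstrassP L) w - (6 * weierstrassP L w ^ 2 - L.g₂ / 2)) = 0 := by
    intro w hw
    have hP : HasDerivAt (weierstrassP L) (derivWeierstrassP L w) w := by
      have := (L.differentiableOn_weierstrassP.differentiableAt (lat_mem_nhds L _ hw)).hasDerivAt
      rwa [deriv_weierstrassP] at this
    have hQ := (L.differentiableOn_derivWeierstrassP.differentiableAt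
      (lat_mem_nhds L _ hw)).hasDerivAt
    have h1 : HasDerivAt (fun z => derivWeierstrassP L z ^ 2)
      (2 * derivWeierstrassP L w * deriv (derivWeierstrassP L) w) w := by
      simpa using hQ.fun_pow 2
    have h2 : HasDerivAt (fun z => 4 * weierstrassP L z ^ 3 - L.g₂ * weierstrassP L z - L.g₃)
      (4 * (3 * weierstrassP L w ^ 2 * derivWeierstrassP L w) - L.g₂ * derivWeierstrassP L w) w := by
      simpa using (((hP.fun_pow 3).const_mul 4).fun_sub (hP.const_mul L.g₂)).sub_const L.g₃
    have h3 := h1.congr_of_eventuallyEq (f₁ := fun z =>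
      4 * weierstrassP L z ^ 3 - L.g₂ * weierstrassP L z - L.g₃) (by
        filter_upwards [lat_mem_nhds L _ hw] with z hz
        exact (L.derivWeierstrassP_sq z hz).symm)
    have := h3.unique h2
    linear_combination this / 2
  rcases (han z hz).eventually_eq_zero_or_eventually_ne_zero with h | h
  · exfalso
    have h0 := han.eqOn_zero_of_preconnected_of_eventuallyEq_zero hcn hz h
    -- then P' = 0 near 0 on the real axis
    have hd : (L.lattice \ {0} : Set ℂ)ᶜ ∈ 𝓝 (0:ℂ) := L.compl_lattice_sdiff_singleton_mem_nhds 0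
    obtain ⟨r, hr0, hr⟩ := Metric.mem_nhds_iff.1 hd
    have hnm : ∀ t ∈ Ioo 0 r, (t:ℂ) ∉ L.lattice := by
      intro t ht hm
      have : (t:ℂ) ∈ Metric.ball (0:ℂ) r := by
        simp [abs_of_pos ht.1, ht.2]
      exact hr this ⟨hm, by simpa using ht.1.ne'⟩
    have hconst : ∀ x ∈ Ioo 0 r, ∀ y ∈ Ioo 0 r,
        (weierstrassP L (x:ℝ)).re = (weierstrassP L (y:ℝ)).re := by
      intro x hx y hy
      refine (convex_Ioo 0 r).is_const_of_fderivWithin_eq_zero (𝕜 := ℝ)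
        (f := fun t : ℝ => (weierstrassP L t).re) ?_ ?_ hx hy
      · exact fun t ht => (lat_hp L t (hnm t ht)).differentiableAt.differentiableWithinAt
      · intro t ht
        have h5 := lat_hp L t (hnm t ht)
        rw [h0 (hnm t ht)] at h5
        rw [fderivWithin_of_isOpen isOpen_Ioo ht, h5.hasFDerivAt.fderiv]
        ext; simp
    have hh : r / 2 ∈ Ioo 0 r := ⟨by linarith, by linarith⟩
    obtain ⟨x, hx1, hx2⟩ := (((lat_lim L).eventually_gt_atTop
      (weierstrassP L ((r/2 : ℝ):ℂ)).re).and (Ioo_mem_nhdsGT hr0)).exists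
    have := hconst x hx2 _ hh
    linarith
  · have hz' := lat_mem_nhds L z hz
    have hcont : ContinuousAt (fun w => deriv (derivWeierstrassP L) w -
        (6 * weierstrassP L w ^ 2 - L.g₂ / 2)) z := by
      have c1 := (han z hz).deriv.continuousAt
      have c2 := (L.analyticOnNhd_weierstrassP z hz).continuousAt
      fun_prop
    have ht1 := hcont.tendsto.mono_left (nhdsWithin_le_nhds (s := {z}ᶜ))
    have ht2 : Tendsto (fun w => deriv (derivWeierstrassP L) w -
        (6 * weierstrassP L w ^ 2 - L.g₂ / 2)) (𝓝[≠] z) (𝓝 0) := by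
      refine tendsto_const_nhds.congr' ?_
      filter_upwards [h, nhdsWithin_le_nhds hz'] with w hw hw2
      exact ((mul_eq_zero.1 (hrel w hw2)).resolve_left hw).symm
    have := tendsto_nhds_unique ht1 ht2
    exact sub_eq_zero.1 this

end

lemma aux_neg (p dp : ℝ → ℝ) (a : ℝ)
    (hp : ∀ t ∈ Ioo (0:ℝ) 1, HasDerivAt p (dp t) t)
    (hdp : ∀ t ∈ Ioo (0:ℝ) 1, HasDerivAt dp (6 * p t ^ 2 - a) t)
    (hlim : Tendsto p (𝓝[>] 0) atTop) : ∀ t ∈ Ioo (0:ℝ) (1/2), dp t < 0 := by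
  have hne : ∀ t ∈ Ioo (0:ℝ) (1/2), dp t ≠ 0 := by
    intro t₀ ht₀ h0
    have hsym : ∀ s ∈ Ico 0 t₀, p (t₀ + s) = p (t₀ - s) := by
      intro s hs
      let v : ℝ → ℝ × ℝ → ℝ × ℝ := fun _ y => (y.2, 6 * y.1 ^ 2 - a)
      let f : ℝ → ℝ × ℝ := fun s => (p (t₀ + s), dp (t₀ + s))
      let g : ℝ → ℝ × ℝ := fun s => (p (t₀ - s), - dp (t₀ - s))
      have hf : ∀ x ∈ Icc 0 s, HasDerivAt f (v x (f x)) x := by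
        intro x hx
        have hm : t₀ + x ∈ Ioo (0:ℝ) 1 := by
          constructor <;> linarith [hx.1, hx.2, hs.1, hs.2, ht₀.1, ht₀.2]
        exact ((hp _ hm).comp_const_add t₀ x).prodMk ((hdp _ hm).comp_const_add t₀ x)
      have hg : ∀ x ∈ Icc 0 s, HasDerivAt g (v x (g x)) x := by
        intro x hx
        have hm : t₀ - x ∈ Ioo (0:ℝ) 1 := by
          constructor <;> linarith [hx.1, hx.2, hs.1, hs.2, ht₀.1, ht₀.2]
        have h1 := (hp _ hm).comp_const_sub t₀ x
        have h2 := ((hdp _ hm).comp_const_sub t₀ x).neg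
        simp only [neg_neg] at h2
        exact h1.prodMk h2
      have hfc : ContinuousOn f (Icc 0 s) := fun x hx => (hf x hx).continuousAt.continuousWithinAt
      have hgc : ContinuousOn g (Icc 0 s) := fun x hx => (hg x hx).continuousAt.continuousWithinAt
      have hK : IsCompact (f '' Icc 0 s ∪ g '' Icc 0 s) :=
        (isCompact_Icc.image_of_continuousOn hfc).union (isCompact_Icc.image_of_continuousOn hgc)
      obtain ⟨R, hR⟩ := hK.isBounded.subset_closedBall (0 : ℝ × ℝ)
      have hv : ContDiff ℝ 1 (v 0) := by
        simp only [v]; fun_prop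
      obtain ⟨K, hKl⟩ : ∃ K, LipschitzOnWith K (v 0) (Metric.closedBall 0 R) :=
        hv.contDiffOn.exists_lipschitzOnWith (by simp) (convex_closedBall _ _)
          (isCompact_closedBall _ _)
      have := ODE_solution_unique_of_mem_Icc_right (v := v) (s := fun _ => Metric.closedBall 0 R)
        (K := K) (f := f) (g := g) (a := 0) (b := s)
        (fun t _ => hKl) hfc (fun t ht => (hf t (Ico_subset_Icc_self ht)).hasDerivWithinAt)
        (fun t ht => hR (Or.inl ⟨t, Ico_subset_Icc_self ht, rfl⟩)) hgc
        (fun t ht => (hg t (Ico_subset_Icc_self ht)).hasDerivWithinAt)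
        (fun t ht => hR (Or.inr ⟨t, Ico_subset_Icc_self ht, rfl⟩)) (by simp [f, g, h0])
        ⟨hs.1, le_rfl⟩
      exact congrArg Prod.fst this
    -- p (2 t₀ - x) = p x for x in (0, t₀]
    have hc : Tendsto (fun x => p (2 * t₀ - x)) (𝓝[>] 0) (𝓝 (p (2 * t₀))) := by
      have : ContinuousAt p (2 * t₀ - 0) :=
        (hp (2 * t₀ - 0) ⟨by linarith [ht₀.1], by linarith [ht₀.2]⟩).continuousAt
      have h2 : ContinuousAt (fun x => p (2 * t₀ - x)) 0 :=
        ContinuousAt.comp (f := fun x => 2 * t₀ - x) this (by fun_prop)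
      have := h2.tendsto.mono_left (nhdsWithin_le_nhds (s := Ioi 0))
      simpa using this
    have hc2 : Tendsto p (𝓝[>] 0) (𝓝 (p (2 * t₀))) := by
      refine hc.congr' ?_
      filter_upwards [Ioo_mem_nhdsGT ht₀.1] with x hx
      have := hsym (t₀ - x) ⟨by linarith [hx.2], by linarith [hx.1]⟩
      rw [show t₀ + (t₀ - x) = 2 * t₀ - x by ring, show t₀ - (t₀ - x) = x by ring] at this
      exact this
    exact not_tendsto_nhds_of_tendsto_atTop hlim _ hc2
  by_contra! hcon
  obtain ⟨t, ht, hpos⟩ := hcon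
  have hcont : ContinuousOn dp (Ioo (0:ℝ) (1/2)) := fun x hx =>
    (hdp x ⟨hx.1, by linarith [hx.2]⟩).continuousAt.continuousWithinAt
  have hall : ∀ x ∈ Ioo (0:ℝ) (1/2), 0 < dp x := by
    intro x hx
    by_contra! hx0
    have := isPreconnected_Ioo.intermediate_value hx ht hcont ⟨hx0, hpos⟩
    obtain ⟨y, hy, hy0⟩ := this
    exact hne y hy hy0
  have hmono : StrictMonoOn p (Ioo (0:ℝ) (1/2)) := by
    apply strictMonoOn_of_deriv_pos (convex_Ioo _ _)
    · exact fun x hx => (hp x ⟨hx.1, by linarith [hx.2]⟩).continuousAt.continuousWithinAt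
    · intro x hx
      rw [interior_Ioo] at hx
      rw [(hp x ⟨hx.1, by linarith [hx.2]⟩).deriv]
      exact hall x hx
  obtain ⟨x, hx1, hx2⟩ := ((hlim.eventually_gt_atTop (p t)).and (Ioo_mem_nhdsGT ht.1)).exists
  have := hmono ⟨hx2.1, hx2.2.trans ht.2⟩ ht hx2.2
  linarith

lemma aux_anti (p dp : ℝ → ℝ)
    (hp : ∀ t ∈ Ioo (0:ℝ) 1, HasDerivAt p (dp t) t)
    (hneg : ∀ t ∈ Ioo (0:ℝ) (1/2), dp t < 0) : StrictAntiOn p (Ioc (0:ℝ) (1/2)) := by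
  apply strictAntiOn_of_deriv_neg (convex_Ioc _ _)
  · exact fun x hx => (hp x ⟨hx.1, by linarith [hx.2]⟩).continuousAt.continuousWithinAt
  · intro x hx
    rw [interior_Ioc] at hx
    rw [(hp x ⟨hx.1, by linarith [hx.2]⟩).deriv]
    exact hneg x hx

lemma aux_image (p dp : ℝ → ℝ)
    (hp : ∀ t ∈ Ioo (0:ℝ) 1, HasDerivAt p (dp t) t)
    (hneg : ∀ t ∈ Ioo (0:ℝ) (1/2), dp t < 0)
    (hlim : Tendsto p (𝓝[>] 0) atTop) : p '' Ioo (0:ℝ) (1/2) = Ioi (p (1/2)) := by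
  have hanti := aux_anti p dp hp hneg
  apply Subset.antisymm
  · rintro _ ⟨x, hx, rfl⟩
    exact hanti ⟨hx.1, hx.2.le⟩ ⟨by norm_num, le_rfl⟩ hx.2
  · intro y hy
    obtain ⟨x, hx1, hx2⟩ := ((hlim.eventually_gt_atTop y).and
      (Ioo_mem_nhdsGT (show (0:ℝ) < 1/2 by norm_num))).exists
    have hc : ContinuousOn p (Icc x (1/2)) := fun z hz =>
      (hp z ⟨by linarith [hz.1, hx2.1], by linarith [hz.2]⟩).continuousAt.continuousWithinAt
    obtain ⟨z, hz, rfl⟩ := intermediate_value_Ioo' hx2.2.le hc ⟨hy, hx1⟩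
    exact ⟨z, ⟨hx2.1.trans hz.1, hz.2⟩, rfl⟩

lemma aux_beta (p dp : ℝ → ℝ) (k : ℕ) (hk : 0 < k) (e : ℝ) (he : 0 < e)
    (hp : ∀ t ∈ Ioo (0:ℝ) 1, HasDerivAt p (dp t) t)
    (hneg : ∀ t ∈ Ioo (0:ℝ) (1/2), dp t < 0)
    (hlim : Tendsto p (𝓝[>] 0) atTop) (hhalf : p (1/2) = e)
    (hsq : ∀ t ∈ Ioo (0:ℝ) (1/2), dp t ^ 2 = 4 * p t ^ 3 * (1 - (e / p t) ^ k)) :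
    ∫ u in Ioo (0:ℝ) 1, u ^ (1 / (2 * (k:ℝ)) - 1) * (1 - u) ^ ((1/2 : ℝ) - 1)
      = k * Real.sqrt e := by
  have hanti := aux_anti p dp hp hneg
  have him := aux_image p dp hp hneg hlim
  rw [hhalf] at him
  have hpe : ∀ t ∈ Ioo (0:ℝ) (1/2), e < p t := fun t ht => by
    have : p t ∈ Ioi e := him ▸ mem_image_of_mem p ht
    exact this
  have hinj : InjOn (fun t => (e / p t) ^ k) (Ioo (0:ℝ) (1/2)) := by
    intro x hx y hy hxy
    have h1 : 0 < p x := he.trans (hpe x hx)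
    have h2 : 0 < p y := he.trans (hpe y hy)
    have := (pow_left_inj₀ (by positivity) (by positivity) hk.ne').1 hxy
    have h3 : p x = p y := by
      rw [div_eq_div_iff h1.ne' h2.ne'] at this
      exact (mul_left_cancel₀ he.ne' this).symm
    exact hanti.injOn ⟨hx.1, hx.2.le⟩ ⟨hy.1, hy.2.le⟩ h3
  have himage : (fun t => (e / p t) ^ k) '' Ioo (0:ℝ) (1/2) = Ioo 0 1 := by
    rw [show (fun t => (e / p t) ^ k) = (fun x => (e / x) ^ k) ∘ p from rfl, image_comp, him]
    ext u
    constructor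
    · rintro ⟨x, hx, rfl⟩
      have hx : e < x := hx
      have : 0 < x := he.trans hx
      refine ⟨by positivity, pow_lt_one₀ (by positivity) ?_ hk.ne'⟩
      rwa [div_lt_one this]
    · intro hu
      have hu0 := hu.1
      refine ⟨e / u ^ (1 / (k:ℝ)), ?_, ?_⟩
      · have h1 : u ^ (1 / (k:ℝ)) < 1 := Real.rpow_lt_one hu.1.le hu.2 (by positivity)
        have h0 : 0 < u ^ (1 / (k:ℝ)) := by positivity
        rw [mem_Ioi, lt_div_iff₀ h0]
        nlinarith
      · have h0 : 0 < u ^ (1 / (k:ℝ)) := by positivity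
        simp only
        rw [div_div_cancel₀ he.ne', ← Real.rpow_natCast, ← Real.rpow_mul hu.1.le]
        field_simp
        simp
  have hder : ∀ t ∈ Ioo (0:ℝ) (1/2), HasDerivWithinAt (fun t => (e / p t) ^ k)
      (k * (e / p t) ^ (k - 1) * (-(e * dp t) / p t ^ 2)) (Ioo (0:ℝ) (1/2)) t := by
    intro t ht
    have h1 := hpe t ht
    have h0 : p t ≠ 0 := by linarith
    have h := hp t ⟨ht.1, by linarith [ht.2]⟩
    have h2 := ((hasDerivAt_const t e).div h h0).pow k
    have h3 : HasDerivAt (fun t => (e / p t) ^ k)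
      (k * (e / p t) ^ (k - 1) * ((0 * p t - e * dp t) / p t ^ 2)) t := h2
    rw [zero_mul, zero_sub] at h3
    exact h3.hasDerivWithinAt
  rw [← himage, integral_image_eq_integral_abs_deriv_smul measurableSet_Ioo hder hinj]
  have hconst : ∀ t ∈ Ioo (0:ℝ) (1/2),
      |k * (e / p t) ^ (k - 1) * (-(e * dp t) / p t ^ 2)| •
      (((e / p t) ^ k) ^ (1 / (2 * (k:ℝ)) - 1) * (1 - (e / p t) ^ k) ^ ((1/2 : ℝ) - 1))
      = 2 * k * Real.sqrt e := by
    intro t ht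
    have h1 := hpe t ht
    have h0 : 0 < p t := by linarith
    have hn := hneg t ht
    have hlt : e / p t < 1 := by rwa [div_lt_one h0]
    have hr0 : 0 < e / p t := by positivity
    set r := e / p t with hr
    have hr1 : r ^ k < 1 := pow_lt_one₀ hr0.le hlt hk.ne'
    have hw : 0 < 1 - r ^ k := by linarith
    have hpt : p t = e / r := by rw [hr]; field_simp
    have hdp : dp t = - (2 * (p t * Real.sqrt (p t)) * Real.sqrt (1 - r ^ k)) := by
      have h3 : (-dp t) ^ 2 = (2 * (p t * Real.sqrt (p t)) * Real.sqrt (1 - r ^ k)) ^ 2 := by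
        rw [neg_sq, hsq t ht, mul_pow, mul_pow, mul_pow, Real.sq_sqrt h0.le, Real.sq_sqrt hw.le]
        ring
      have := (pow_left_inj₀ (by linarith) (by positivity) two_ne_zero).1 h3
      linarith
    have habs : |k * r ^ (k - 1) * (-(e * dp t) / p t ^ 2)|
        = k * r ^ (k - 1) * (-(e * dp t) / p t ^ 2) := by
      apply abs_of_pos
      have : 0 < -(e * dp t) := by nlinarith
      positivity
    rw [habs, smul_eq_mul]
    have e1 : (r ^ k) ^ (1 / (2 * (k:ℝ)) - 1) = Real.sqrt r / r ^ k := by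
      rw [Real.rpow_sub_one (by positivity), ← Real.rpow_natCast, ← Real.rpow_mul hr0.le,
        Real.sqrt_eq_rpow]
      congr 2
      field_simp
    have e2 : (1 - r ^ k) ^ ((1/2 : ℝ) - 1) = 1 / Real.sqrt (1 - r ^ k) := by
      rw [Real.rpow_sub_one hw.ne', ← Real.sqrt_eq_rpow]
      have := Real.sqrt_pos.2 hw
      nth_rw 2 [← Real.sq_sqrt hw.le]
      field_simp
    rw [e1, e2, hdp]
    have hs := Real.sqrt_pos.2 hw
    have hsp := Real.sqrt_pos.2 h0
    have hse : Real.sqrt e = Real.sqrt r * Real.sqrt (p t) := by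
      rw [← Real.sqrt_mul hr0.le, hr]; congr 1; field_simp
    have hrk : r ^ k = r ^ (k - 1) * r := by rw [← pow_succ]; congr 1; omega
    rw [hse]
    generalize Real.sqrt (1 - r ^ k) = S at *
    rw [hrk]
    have hee : e = r * p t := by rw [hr]; field_simp
    have hsr := Real.sqrt_pos.2 hr0
    rw [hee]
    field_simp
  rw [setIntegral_congr_fun measurableSet_Ioo hconst]
  simp
  ring

lemma lat_real (L : PeriodPair) (hc : ∀ x ∈ L.lattice, conj x ∈ L.lattice) (t : ℝ) :
    weierstrassP L t = ((weierstrassP L t).re : ℂ) :=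
  (Complex.conj_eq_iff_re.1 (conj_P L hc t)).symm

lemma lat_dreal (L : PeriodPair) (hc : ∀ x ∈ L.lattice, conj x ∈ L.lattice) (t : ℝ) :
    derivWeierstrassP L t = ((derivWeierstrassP L t).re : ℂ) :=
  (Complex.conj_eq_iff_re.1 (conj_dP L hc t)).symm

lemma lat_half (L : PeriodPair) (h1 : (1:ℂ) ∈ L.lattice) :
    derivWeierstrassP L ((1/2 : ℝ) : ℂ) = 0 := by
  have h2 := L.derivWeierstrassP_add_coe (-((1/2 : ℝ) : ℂ)) ⟨1, h1⟩
  rw [derivWeierstrassP_neg] at h2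
  rw [show -((1/2 : ℝ) : ℂ) + (⟨1, h1⟩ : L.lattice).1 = ((1/2 : ℝ) : ℂ) by push_cast; norm_num]
    at h2
  linear_combination h2 / 2

lemma lat_core (L : PeriodPair) (hc : ∀ x ∈ L.lattice, conj x ∈ L.lattice)
    (hr : ∀ t ∈ Ioo (0:ℝ) 1, (t:ℂ) ∉ L.lattice) (h1 : (1:ℂ) ∈ L.lattice)
    (a b : ℝ) (ha : L.g₂ = a) (hb : L.g₃ = b) :
    ∃ (p dp : ℝ → ℝ), (∀ t ∈ Ioo (0:ℝ) 1, HasDerivAt p (dp t) t) ∧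
      (∀ t ∈ Ioo (0:ℝ) (1/2), dp t < 0) ∧ Tendsto p (𝓝[>] 0) atTop ∧
      (∀ t ∈ Ioo (0:ℝ) 1, dp t ^ 2 = 4 * p t ^ 3 - a * p t - b) ∧ dp (1/2) = 0 := by
  have hp : ∀ t ∈ Ioo (0:ℝ) 1, HasDerivAt (fun t : ℝ => (weierstrassP L t).re)
      (derivWeierstrassP L t).re t := fun t ht => lat_hp L t (hr t ht)
  refine ⟨fun t => (weierstrassP L t).re, fun t => (derivWeierstrassP L t).re, hp, ?_,
    lat_lim L, ?_, ?_⟩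
  · refine aux_neg _ _ (a / 2) hp ?_ (lat_lim L)
    intro t ht
    have := lat_hdp L t (hr t ht)
    convert this using 1
    rw [lat_ddP L _ (hr t ht), ha, lat_real L hc]
    norm_cast
  · intro t ht
    have := L.derivWeierstrassP_sq t (hr t ht)
    rw [lat_real L hc, lat_dreal L hc, ha, hb] at this
    exact_mod_cast this
  · simp only [lat_half L h1, Complex.zero_re]

lemma lat_four (L : PeriodPair) (hc : ∀ x ∈ L.lattice, conj x ∈ L.lattice)
    (hr : ∀ t ∈ Ioo (0:ℝ) 1, (t:ℂ) ∉ L.lattice) (h1 : (1:ℂ) ∈ L.lattice)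
    (a : ℝ) (ha0 : 0 < a) (ha : L.g₂ = a) (hb : L.g₃ = 0) :
    a = 1 / 4 * (Real.Gamma (1/4) * Real.Gamma (1/2) / Real.Gamma (3/4)) ^ 4 := by
  obtain ⟨p, dp, hp, hneg, hlim, hsq, hhalf⟩ := lat_core L hc hr h1 a 0 ha (by simpa using hb)
  have him := aux_image p dp hp hneg hlim
  have hroot := hsq (1/2) ⟨by norm_num, by norm_num⟩
  rw [hhalf] at hroot
  set e := p (1/2) with he
  have hs : 0 < Real.sqrt a := Real.sqrt_pos.2 ha0
  have hs2 : Real.sqrt a ^ 2 = a := Real.sq_sqrt ha0.le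
  have hge : Real.sqrt a / 2 ≤ e := by
    by_contra! hlt
    have hm : Real.sqrt a / 2 ∈ Ioi e := hlt
    rw [← him] at hm
    obtain ⟨t, ht, hpt⟩ := hm
    have h2 := hsq t ⟨ht.1, by linarith [ht.2]⟩
    have h3 := hneg t ht
    rw [hpt] at h2
    have : dp t ^ 2 = 0 := by linear_combination h2 + Real.sqrt a / 2 * hs2
    have := pow_eq_zero_iff (two_ne_zero) |>.1 this
    linarith
  have he0 : 0 < e := by linarith
  have hae : a = 4 * e ^ 2 := by
    have : e * (4 * e ^ 2 - a) = 0 := by linarith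
    have := (mul_eq_zero.1 this).resolve_left he0.ne'
    linarith
  have hB := aux_beta p dp 2 (by norm_num) e he0 hp hneg hlim rfl (by
    intro t ht
    have : p t ∈ Ioi e := him ▸ mem_image_of_mem p ht
    have : 0 < p t := he0.trans this
    rw [hsq t ⟨ht.1, by linarith [ht.2]⟩, hae]
    field_simp
    ring)
  have hB2 := real_beta (1/4) (1/2) (by norm_num) (by norm_num)
  norm_num at hB hB2
  norm_num
  rw [← hB2, hB, hae]
  have : Real.sqrt e ^ 2 = e := Real.sq_sqrt he0.le
  linear_combination (-4) * (Real.sqrt e ^ 2 + e) * this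

lemma lat_six (L : PeriodPair) (hc : ∀ x ∈ L.lattice, conj x ∈ L.lattice)
    (hr : ∀ t ∈ Ioo (0:ℝ) 1, (t:ℂ) ∉ L.lattice) (h1 : (1:ℂ) ∈ L.lattice)
    (b : ℝ) (hb0 : 0 < b) (ha : L.g₂ = 0) (hb : L.g₃ = b) :
    b = 4 / 729 * (Real.Gamma (1/6) * Real.Gamma (1/2) / Real.Gamma (2/3)) ^ 6 := by
  obtain ⟨p, dp, hp, hneg, hlim, hsq, hhalf⟩ := lat_core L hc hr h1 0 b (by simpa using ha) hb
  have him := aux_image p dp hp hneg hlim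
  have hroot := hsq (1/2) ⟨by norm_num, by norm_num⟩
  rw [hhalf] at hroot
  set e := p (1/2) with he
  have hbe : b = 4 * e ^ 3 := by linarith
  have he0 : 0 < e := by
    have : 0 < e ^ 3 := by linarith
    exact (Odd.pow_pos_iff (by decide)).1 this
  have hB := aux_beta p dp 3 (by norm_num) e he0 hp hneg hlim rfl (by
    intro t ht
    have : p t ∈ Ioi e := him ▸ mem_image_of_mem p ht
    have : 0 < p t := he0.trans this
    rw [hsq t ⟨ht.1, by linarith [ht.2]⟩, hbe]
    field_simp
    ring)
  have hB2 := real_beta (1/6) (1/2) (by norm_num) (by norm_num)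
  norm_num at hB hB2
  norm_num
  rw [← hB2, hB, hbe]
  have : Real.sqrt e ^ 6 = e ^ 3 := by
    rw [show 6 = 2 * 3 by norm_num, pow_mul, Real.sq_sqrt he0.le]
  linear_combination (-4) * this

lemma gamma_four : 1 / 4 * (Real.Gamma (1/4) * Real.Gamma (1/2) / Real.Gamma (3/4)) ^ 4
    = Real.Gamma (1/4) ^ 8 / (16 * Real.pi ^ 2) := by
  have h := Real.Gamma_mul_Gamma_one_sub (1/4)
  rw [show Real.pi * (1/4) = Real.pi / 4 by ring, Real.sin_pi_div_four] at h
  rw [show (1:ℝ) - 1/4 = 3/4 by norm_num] at h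
  rw [Real.Gamma_one_half_eq]
  have g1 : 0 < Real.Gamma (1/4) := Real.Gamma_pos_of_pos (by norm_num)
  have hp := Real.pi_pos
  have h3 : Real.Gamma (3/4) = Real.pi / (Real.sqrt 2 / 2) / Real.Gamma (1/4) := by
    rw [← h]; field_simp
  have hs2 : Real.sqrt 2 ^ 4 = 4 := by
    rw [show 4 = 2 * 2 by norm_num, pow_mul, Real.sq_sqrt (by norm_num)]; norm_num
  have hsp : Real.sqrt Real.pi ^ 4 = Real.pi ^ 2 := by
    rw [show 4 = 2 * 2 by norm_num, pow_mul, Real.sq_sqrt hp.le]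
  have : (0:ℝ) < Real.sqrt 2 := by positivity
  rw [h3]
  field_simp
  rw [hs2, hsp]
  ring

lemma gamma_six : 4 / 729 * (Real.Gamma (1/6) * Real.Gamma (1/2) / Real.Gamma (2/3)) ^ 6
    = Real.Gamma (1/3) ^ 18 / (64 * Real.pi ^ 6) := by
  have h := Real.Gamma_mul_Gamma_one_sub (1/3)
  rw [show Real.pi * (1/3) = Real.pi / 3 by ring, Real.sin_pi_div_three] at h
  rw [show (1:ℝ) - 1/3 = 2/3 by norm_num] at h
  have hd := Real.Gamma_mul_Gamma_add_half (1/6)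
  rw [show (1:ℝ)/6 + 1/2 = 2/3 by norm_num, show 2 * ((1:ℝ)/6) = 1/3 by norm_num,
    show (1:ℝ) - 1/3 = 2/3 by norm_num] at hd
  rw [Real.Gamma_one_half_eq]
  have g1 : 0 < Real.Gamma (1/3) := Real.Gamma_pos_of_pos (by norm_num)
  have g2 : 0 < Real.Gamma (2/3) := Real.Gamma_pos_of_pos (by norm_num)
  have hp := Real.pi_pos
  have h3 : Real.Gamma (2/3) = Real.pi / (Real.sqrt 3 / 2) / Real.Gamma (1/3) := by
    rw [← h]; field_simp
  have h6 : Real.Gamma (1/6) = Real.Gamma (1/3) * 2 ^ ((2:ℝ)/3) * Real.sqrt Real.pi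
      / Real.Gamma (2/3) := by rw [← hd]; field_simp
  have hs3 : Real.sqrt 3 ^ 12 = 729 := by
    rw [show 12 = 2 * 6 by norm_num, pow_mul, Real.sq_sqrt (by norm_num)]; norm_num
  have hsp : Real.sqrt Real.pi ^ 12 = Real.pi ^ 6 := by
    rw [show 12 = 2 * 6 by norm_num, pow_mul, Real.sq_sqrt hp.le]
  have h26 : ((2:ℝ) ^ ((2:ℝ)/3)) ^ 6 = 16 := by
    rw [← Real.rpow_natCast, ← Real.rpow_mul (by norm_num)]; norm_num
  have : (0:ℝ) < Real.sqrt 3 := by positivity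
  rw [h6, h3]
  field_simp
  rw [hs3, hsp, h26]
  ring

lemma lp_indep (z : UpperHalfPlane) : LinearIndependent ℝ ![(z:ℂ), 1] := by
  rw [LinearIndependent.pair_iff]
  intro s t h
  have h1 := congrArg Complex.im h
  have h2 := congrArg Complex.re h
  simp at h1 h2
  have hz : z.im ≠ 0 := z.im_ne_zero
  have hs : s = 0 := by
    rcases h1 with h | h
    · exact h
    · exact absurd h hz
  subst hs
  simpa using h2

/-- The lattice `ℤ z + ℤ`. -/
noncomputable def tauPair (z : UpperHalfPlane) : PeriodPair := ⟨z, 1, lp_indep z⟩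

lemma lp_mem (z : UpperHalfPlane) (x : ℂ) :
    x ∈ (tauPair z).lattice ↔ ∃ m n : ℤ, m * (z:ℂ) + n = x := by
  rw [mem_lattice]; simp [tauPair]

lemma lp_one (z : UpperHalfPlane) : (1:ℂ) ∈ (tauPair z).lattice := by
  rw [lp_mem]; exact ⟨0, 1, by simp⟩

lemma lp_real (z : UpperHalfPlane) : ∀ t ∈ Ioo (0:ℝ) 1, (t:ℂ) ∉ (tauPair z).lattice := by
  intro t ht h
  rw [lp_mem] at h
  obtain ⟨m, n, h⟩ := h
  have h1 := congrArg Complex.im h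
  have h2 := congrArg Complex.re h
  simp at h1 h2
  have hm : m = 0 := by
    rcases h1 with h | h
    · exact h
    · exact absurd h z.im_ne_zero
  subst hm
  simp at h2
  have a1 := ht.1
  have a2 := ht.2
  rw [← h2] at a1 a2
  have b1 : 0 < n := by exact_mod_cast a1
  have b2 : n < 1 := by exact_mod_cast a2
  omega

lemma lp_G (z : UpperHalfPlane) (k : ℕ) :
    (tauPair z).G k = ∑' v : Fin 2 → ℤ, EisensteinSeries.eisSummand k v z := by
  rw [PeriodPair.G, ← (tauPair z).latticeEquivProd.symm.toEquiv.tsum_eq,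
    ← (finTwoArrowEquiv ℤ).tsum_eq]
  refine tsum_congr fun v => ?_
  have := (tauPair z).latticeEquiv_symm_apply (finTwoArrowEquiv ℤ v)
  simp only [LinearEquiv.coe_toEquiv]
  rw [this]
  simp [EisensteinSeries.eisSummand, tauPair, finTwoArrowEquiv]

lemma tsum_conv (k : ℕ) (z : UpperHalfPlane) :
    ∑' (n : ℕ+), (ArithmeticFunction.sigma k n : ℂ) *
      Complex.exp (2 * Real.pi * Complex.I * z) ^ (n : ℕ)
    = ∑' n : ℕ, (sigmaFn k (n + 1) : ℂ) * qp z ((n : ℂ) + 1) := by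
  rw [tsum_pnat_eq_tsum_succ (f := fun n : ℕ => (ArithmeticFunction.sigma k n : ℂ) *
      Complex.exp (2 * Real.pi * Complex.I * z) ^ (n : ℕ))]
  refine tsum_congr fun n => ?_
  rw [ArithmeticFunction.sigma_apply, sigmaFn, qp, ← Complex.exp_nat_mul]
  congr 2
  push_cast
  ring

lemma g2_eq (z : UpperHalfPlane) : (tauPair z).g₂ = 4 * (Real.pi:ℂ) ^ 4 / 3 * E4 z := by
  have h := tsum_eisSummand_eq_tsum_sigma_mul_cexp_pow (k := 4) (by norm_num) (by decide) z
  rw [← lp_G] at h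
  simp only [Nat.add_one_sub_one, Nat.reduceSub] at h
  rw [tsum_conv] at h
  push_cast at h
  rw [riemannZeta_four] at h
  rw [PeriodPair.g₂, h, E4]
  rw [mul_pow, Complex.I_pow_four]
  norm_num [Nat.factorial]
  ring

lemma bern6 : bernoulli 6 = 1 / 42 := by
  rw [bernoulli_eq_bernoulli'_of_ne_one (by norm_num)]
  have h5 : bernoulli' 5 = 0 := by
    rw [bernoulli'_def]
    norm_num [Finset.sum_range_succ, Nat.choose]
  rw [bernoulli'_def]
  norm_num [Finset.sum_range_succ, h5, Nat.choose]

lemma zeta6 : riemannZeta 6 = (Real.pi:ℂ) ^ 6 / 945 := by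
  have := riemannZeta_two_mul_nat (k := 3) (by norm_num)
  norm_num [bern6, Nat.factorial] at this
  rw [this]
  ring

lemma g3_eq (z : UpperHalfPlane) : (tauPair z).g₃ = 8 * (Real.pi:ℂ) ^ 6 / 27 * E6 z := by
  have h := tsum_eisSummand_eq_tsum_sigma_mul_cexp_pow (k := 6) (by norm_num) (by decide) z
  rw [← lp_G] at h
  simp only [Nat.add_one_sub_one, Nat.reduceSub] at h
  rw [tsum_conv] at h
  push_cast at h
  rw [zeta6] at h
  rw [PeriodPair.g₃, h, E6]
  rw [mul_pow, show Complex.I ^ 6 = -1 by rw [show 6 = 2 * 3 by norm_num, pow_mul]; norm_num]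
  norm_num [Nat.factorial]
  ring

lemma E4_I : ∃ x : ℝ, 0 < x ∧ E4 Complex.I = x := by
  refine ⟨1 + 240 * ∑' n : ℕ, (sigmaFn 3 (n + 1) : ℝ) * Real.exp (-2 * Real.pi * (n + 1)), ?_, ?_⟩
  · have : 0 ≤ ∑' n : ℕ, (sigmaFn 3 (n + 1) : ℝ) * Real.exp (-2 * Real.pi * (n + 1)) :=
      tsum_nonneg fun n => by positivity
    linarith
  · rw [E4]
    push_cast
    congr 2
    refine tsum_congr fun n => ?_
    rw [qp]
    congr 2
    linear_combination (2 * (Real.pi:ℂ) * (n + 1)) * Complex.I_mul_I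

lemma alpha_eq : alphaPt = -1/2 + (Real.sqrt 3 / 2 : ℝ) * Complex.I := by
  rw [alphaPt, show 2 * (Real.pi : ℂ) * Complex.I / 3
    = ((Real.pi - Real.pi / 3 : ℝ) : ℂ) * Complex.I by push_cast; ring, Complex.exp_mul_I,
    ← Complex.ofReal_cos, ← Complex.ofReal_sin, Real.cos_pi_sub, Real.sin_pi_sub,
    Real.cos_pi_div_three, Real.sin_pi_div_three]
  push_cast
  ring

lemma r_bound : Real.exp (-(Real.pi * Real.sqrt 3)) < 1 / 200 := by
  have h1 : (5.4 : ℝ) ≤ Real.pi * Real.sqrt 3 := by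
    have hs : (1.73:ℝ) ≤ Real.sqrt 3 := Real.le_sqrt_of_sq_le (by norm_num)
    nlinarith [Real.pi_gt_d2]
  have h2 : (200:ℝ) < Real.exp 5.4 := by
    have h3 : (2.71:ℝ) < Real.exp 1 := by linarith [Real.exp_one_gt_d9]
    have h4 : (2.71:ℝ)^5 < Real.exp 1 ^ 5 := by gcongr
    have h5 : (1.4:ℝ) ≤ Real.exp 0.4 := by linarith [Real.add_one_le_exp (0.4:ℝ)]
    have h6 : Real.exp 5.4 = Real.exp 1 ^ 5 * Real.exp 0.4 := by
      rw [← Real.exp_nat_mul, ← Real.exp_add]; norm_num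
    rw [h6]
    have : (2.71:ℝ)^5 * 1.4 < Real.exp 1 ^ 5 * Real.exp 0.4 := by
      apply mul_lt_mul h4 h5 (by norm_num) (by positivity)
    refine lt_trans ?_ this
    norm_num
  calc Real.exp (-(Real.pi * Real.sqrt 3)) ≤ Real.exp (-5.4) := Real.exp_le_exp.2 (by linarith)
    _ = (Real.exp 5.4)⁻¹ := Real.exp_neg _
    _ < 1 / 200 := by rw [one_div]; gcongr

lemma sig_bound (n : ℕ) : sigmaFn 5 (n + 2) ≤ 64 * 12 ^ n := by
  have h1 : sigmaFn 5 (n + 2) ≤ (n + 2) ^ 6 := by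
    rw [sigmaFn]
    calc ∑ d ∈ (n+2).divisors, d ^ 5 ≤ (n+2).divisors.card • (n+2) ^ 5 := by
          apply Finset.sum_le_card_nsmul
          intro d hd
          exact Nat.pow_le_pow_left (Nat.divisor_le hd) 5
      _ ≤ (n + 2) * (n+2) ^ 5 := by
          rw [smul_eq_mul]
          exact Nat.mul_le_mul_right _ (Nat.card_divisors_le_self _)
      _ = (n + 2) ^ 6 := by ring
  refine h1.trans ?_
  clear h1
  induction n with
  | zero => norm_num
  | succ m ih =>
    have h2 : (2 * (m + 1 + 2)) ^ 6 ≤ (3 * (m + 2)) ^ 6 := Nat.pow_le_pow_left (by omega) 6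
    rw [mul_pow, mul_pow] at h2
    rw [pow_succ 12 m]
    omega

lemma E6_alpha : ∃ x : ℝ, 0 < x ∧ E6 alphaPt = x := by
  set r := Real.exp (-(Real.pi * Real.sqrt 3)) with hr
  have hrb := r_bound
  rw [← hr] at hrb
  have hr0 : 0 < r := Real.exp_pos _
  set f : ℕ → ℝ := fun n => (sigmaFn 5 (n + 1) : ℝ) * (-r) ^ (n + 1) with hf
  refine ⟨1 - 504 * ∑' n : ℕ, f n, ?_, ?_⟩
  · have hg : HasSum (fun n : ℕ => 64 * r ^ 2 * (12 * r) ^ n) (64 * r ^ 2 * (1 - 12 * r)⁻¹) :=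
      (hasSum_geometric_of_lt_one (by positivity) (by linarith)).mul_left _
    have hb : ∀ n, ‖f (n + 1)‖ ≤ 64 * r ^ 2 * (12 * r) ^ n := by
      intro n
      simp only [hf, norm_mul, norm_pow, norm_neg, Real.norm_natCast, Real.norm_of_nonneg hr0.le]
      have : (sigmaFn 5 (n + 2) : ℝ) ≤ 64 * 12 ^ n := by exact_mod_cast sig_bound n
      calc (sigmaFn 5 (n + 1 + 1) : ℝ) * r ^ (n + 1 + 1) ≤ (64 * 12 ^ n) * r ^ (n + 1 + 1) := by
            gcongr
        _ = _ := by ring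
    have hsum : Summable fun n => f (n + 1) := Summable.of_norm_bounded hg.summable hb
    have hle := tsum_of_norm_bounded hg hb
    have hs : Summable f := (summable_nat_add_iff 1).1 hsum
    rw [hs.tsum_eq_zero_add]
    have f0 : f 0 = -r := by simp [hf, sigmaFn]
    have h1 : ∑' n, f (n + 1) ≤ 64 * r ^ 2 * (1 - 12 * r)⁻¹ := (le_abs_self _).trans hle
    have h2 : 64 * r ^ 2 * (1 - 12 * r)⁻¹ < 1 / 504 := by
      rw [← div_eq_mul_inv, div_lt_iff₀ (by linarith)]
      nlinarith
    rw [f0]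
    linarith
  · rw [E6]
    push_cast
    congr 2
    refine tsum_congr fun n => ?_
    simp only [hf]
    push_cast
    congr 1
    rw [qp, alpha_eq, hr]
    have : Complex.exp (2 * Real.pi * Complex.I * (-1/2 + (Real.sqrt 3 / 2 : ℝ) * Complex.I))
      = -((Real.exp (-(Real.pi * Real.sqrt 3)) : ℝ) : ℂ) := by
      rw [show 2 * (Real.pi:ℂ) * Complex.I * (-1/2 + (Real.sqrt 3 / 2 : ℝ) * Complex.I)
        = -(Real.pi * Complex.I) + ((-(Real.pi * Real.sqrt 3) : ℝ) : ℂ) by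
          push_cast
          linear_combination ((Real.pi:ℂ) * Real.sqrt 3) * Complex.I_mul_I,
        Complex.exp_add, Complex.exp_neg, Complex.exp_pi_mul_I]
      push_cast
      norm_num
    rw [← this, ← Complex.exp_nat_mul]
    congr 1
    push_cast
    ring

lemma E4_val : E4 Complex.I
    = 3 * ((Real.Gamma (1 / 4) : ℝ) : ℂ) ^ 8 / (2 * (Real.pi : ℂ)) ^ 6 := by
  obtain ⟨x, hx0, hx⟩ := E4_I
  have hI : ((UpperHalfPlane.I : UpperHalfPlane) : ℂ) = Complex.I := rfl
  have hg2 := g2_eq UpperHalfPlane.I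
  rw [hI, hx] at hg2
  have hmul : ∀ y ∈ (tauPair UpperHalfPlane.I).lattice, Complex.I * y ∈ (tauPair UpperHalfPlane.I).lattice := by
    intro y hy
    rw [lp_mem] at hy ⊢
    obtain ⟨m, n, rfl⟩ := hy
    refine ⟨n, -m, ?_⟩
    rw [hI]; push_cast
    linear_combination (-(m:ℂ)) * Complex.I_mul_I
  have hG : (tauPair UpperHalfPlane.I).G 6 = 0 := by
    have := G_mul (tauPair UpperHalfPlane.I) Complex.I Complex.I_ne_zero hmul (by
      intro y hy
      rw [Complex.inv_I, neg_mul]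
      exact neg_mem (hmul y hy)) 6
    rw [show Complex.I ^ 6 = -1 by rw [show 6 = 2 * 3 by norm_num, pow_mul]; norm_num] at this
    norm_num at this
    linear_combination this / 2
  have hc : ∀ y ∈ (tauPair UpperHalfPlane.I).lattice, conj y ∈ (tauPair UpperHalfPlane.I).lattice := by
    intro y hy
    rw [lp_mem] at hy ⊢
    obtain ⟨m, n, rfl⟩ := hy
    refine ⟨-m, n, ?_⟩
    rw [hI]
    simp
  have hp := Real.pi_pos
  have := lat_four (tauPair UpperHalfPlane.I) hc (lp_real _) (lp_one _) (4 * Real.pi ^ 4 / 3 * x)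
    (by positivity) (by rw [hg2]; push_cast; rfl) (by rw [PeriodPair.g₃, hG, mul_zero])
  rw [gamma_four] at this
  have hfin : x = 3 * Real.Gamma (1/4) ^ 8 / (2 * Real.pi) ^ 6 := by
    field_simp at this ⊢
    linarith
  rw [hx, hfin]
  push_cast
  rfl

lemma E6_val : E6 alphaPt
    = (27 / 512) * ((Real.Gamma (1 / 3) : ℝ) : ℂ) ^ 18 / (Real.pi : ℂ) ^ 12 := by
  obtain ⟨x, hx0, hx⟩ := E6_alpha
  have hs3 : ((Real.sqrt 3 : ℝ) : ℂ) ^ 2 = 3 := by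
    rw [← Complex.ofReal_pow, Real.sq_sqrt (by norm_num)]; norm_num
  have hsq : alphaPt ^ 2 = -1 - alphaPt := by
    rw [alpha_eq]; push_cast
    linear_combination (((Real.sqrt 3 : ℝ) : ℂ) ^ 2 / 4) * Complex.I_sq - hs3 / 4
  have him : 0 < alphaPt.im := by
    rw [alpha_eq]; simp
  let w : UpperHalfPlane := ⟨alphaPt, him⟩
  have hw : (w : ℂ) = alphaPt := rfl
  have hg3 := g3_eq w
  rw [hw, hx] at hg3
  have ha0 : alphaPt ≠ 0 := fun h => by rw [h] at him; simp at him
  have ha1 : alphaPt ≠ 1 := fun h => by rw [h] at him; simp at him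
  have h3 : alphaPt ^ 3 = 1 := by linear_combination (alphaPt - 1) * hsq
  have hmul : ∀ y ∈ (tauPair w).lattice, alphaPt * y ∈ (tauPair w).lattice := by
    intro y hy
    rw [lp_mem] at hy ⊢
    obtain ⟨m, n, rfl⟩ := hy
    refine ⟨n - m, -m, ?_⟩
    rw [hw]; push_cast
    linear_combination (-(m:ℂ)) * hsq
  have hinv : alphaPt⁻¹ = alphaPt ^ 2 := by
    rw [inv_eq_iff_eq_inv]
    refine eq_inv_of_mul_eq_one_left ?_
    rw [← h3]; ring
  have hG : (tauPair w).G 4 = 0 := by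
    have := G_mul (tauPair w) alphaPt ha0 hmul (by
      intro y hy
      rw [hinv, pow_two, mul_assoc]
      exact hmul _ (hmul y hy)) 4
    rw [show alphaPt ^ 4 = alphaPt by linear_combination alphaPt * h3] at this
    have h4 : (alphaPt - 1) * (tauPair w).G 4 = 0 := by
      have h5 : alphaPt * (tauPair w).G 4 = alphaPt * (alphaPt⁻¹ * (tauPair w).G 4) := by rw [← this]
      rw [mul_inv_cancel_left₀ ha0] at h5
      linear_combination h5
    exact (mul_eq_zero.1 h4).resolve_left (sub_ne_zero.2 ha1)
  have hc : ∀ y ∈ (tauPair w).lattice, conj y ∈ (tauPair w).lattice := by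
    intro y hy
    rw [lp_mem] at hy ⊢
    obtain ⟨m, n, rfl⟩ := hy
    refine ⟨-m, n - m, ?_⟩
    have hca : conj alphaPt = -1 - alphaPt := by
      rw [alpha_eq]
      apply Complex.ext
      · rw [Complex.conj_re]; simp; norm_num
      · rw [Complex.conj_im]; simp
    rw [hw]
    simp [hca]
    ring
  have hp := Real.pi_pos
  have := lat_six (tauPair w) hc (lp_real _) (lp_one _) (8 * Real.pi ^ 6 / 27 * x)
    (by positivity) (by rw [PeriodPair.g₂, hG, mul_zero]) (by rw [hg3]; push_cast; rfl)
  rw [gamma_six] at this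
  have hfin : x = (27 / 512) * Real.Gamma (1/3) ^ 18 / Real.pi ^ 12 := by
    field_simp at this ⊢
    linarith
  rw [hx, hfin]
  push_cast
  rfl

end helpers

/-- `E₄(i) = 12 Ω_{ℚ(i)}⁴ = 3Γ(1/4)⁸/(2π)⁶` and
`E₆(α) = 12^{3/2} Ω_{ℚ(α)}⁶ = (27/512)Γ(1/3)¹⁸/π¹²`. -/
theorem eisenstein_elliptic_values :
    E4 Complex.I = 12 * ((OmegaI : ℝ) : ℂ) ^ 4 ∧
    E4 Complex.I = 3 * ((Real.Gamma (1 / 4) : ℝ) : ℂ) ^ 8 / (2 * (Real.pi : ℂ)) ^ 6 ∧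
    E6 alphaPt = (((12 : ℝ) ^ ((3 : ℝ) / 2) : ℝ) : ℂ) * ((OmegaAlpha : ℝ) : ℂ) ^ 6 ∧
    E6 alphaPt = (27 / 512) * ((Real.Gamma (1 / 3) : ℝ) : ℂ) ^ 18 / (Real.pi : ℂ) ^ 12 := by
  have hp := Real.pi_pos
  refine ⟨?_, E4_val, ?_, E6_val⟩
  · have h : 3 * Real.Gamma (1/4) ^ 8 / (2 * Real.pi) ^ 6 = 12 * OmegaI ^ 4 := by
      have h1 : (Real.pi ^ ((3:ℝ)/2)) ^ 4 = Real.pi ^ 6 := by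
        rw [← Real.rpow_natCast, ← Real.rpow_mul hp.le, ← Real.rpow_natCast]
        norm_num
      rw [OmegaI, div_pow, mul_pow 4, h1]
      field_simp
      norm_num
    rw [E4_val]
    exact_mod_cast h
  · have h : (27 / 512) * Real.Gamma (1/3) ^ 18 / Real.pi ^ 12
        = (12 : ℝ) ^ ((3 : ℝ) / 2) * OmegaAlpha ^ 6 := by
      have h12 : (12:ℝ) ^ ((3:ℝ)/2) * ((3:ℝ) ^ ((1:ℝ)/4)) ^ 6 = 216 := by
        rw [← Real.rpow_natCast, ← Real.rpow_mul (by norm_num : (0:ℝ) ≤ 3),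
          show ((1:ℝ)/4 * ((6:ℕ):ℝ)) = 3/2 by norm_num,
          ← Real.mul_rpow (by norm_num) (by norm_num),
          show (12:ℝ) * 3 = 6 ^ (2:ℝ) by norm_num, ← Real.rpow_mul (by norm_num)]
        norm_num
      rw [OmegaAlpha, div_pow, mul_pow, mul_div_assoc', ← mul_assoc, h12]
      field_simp
      norm_num
    rw [E6_val]
    have h' := congrArg (fun y : ℝ => (y:ℂ)) h
    push_cast at h' ⊢
    exact h'
end
end
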